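/- arXiv:2501.13886 — 3 statements merged into one kernel-verified Lean document; each statement's English description precedes it below -/
import Mathlib

section
/- Let {X_t}_{t≥1} be a non-increasing sequence of nonnegative real numbers converging to 0, and let {α_t}_{t≥1} be a sequence of real numbers such that Σ_{t=1}^∞ α_t X_t converges. Then X_T = o(1 / Σ_{t=1}^T α_t) as T → ∞, i.e. (Σ_{t=1}^T α_t) · X_T → 0. -/
open MeasureTheory ProbabilityTheory Filter
open scoped RealInnerProductSpace ENNReal

/-- **An abstract rate lemma (Lemma `Lem_Reb` of the paper).** If `{Xₜ}` is
nonnegative, non-increasing and tends to `0`, and `∑ αₜ Xₜ` converges, then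
`Xₜ = o(1 / ∑_{t=1}^T αₜ)`. -/
theorem rate_of_summable_weighted
    (X : ℕ → ℝ) (α : ℕ → ℝ)
    (hX0 : ∀ t, 0 ≤ X t)
    (hXmono : ∀ t, X (t + 1) ≤ X t)
    (hXlim : Tendsto X atTop (nhds 0))
    (hsum : ∃ S : ℝ,
      Tendsto (fun T : ℕ => ∑ t ∈ Finset.Icc 1 T, α t * X t) atTop (nhds S)) :
    Tendsto (fun T : ℕ => (∑ t ∈ Finset.Icc 1 T, α t) * X T) atTop (nhds 0) := by
  obtain ⟨S, hS⟩ := hsum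
  have hratio : ∀ n, ∃ r : ℝ, 0 ≤ r ∧ r ≤ 1 ∧ X (n + 1) = r * X n := by
    intro n
    rcases (hX0 n).eq_or_lt with h | h
    · exact ⟨0, le_rfl, zero_le_one, by linarith [hX0 (n + 1), hXmono n]⟩
    · exact ⟨X (n + 1) / X n, div_nonneg (hX0 _) h.le, (div_le_one h).2 (hXmono n),
        (div_mul_cancel₀ _ h.ne').symm⟩
  set A : ℕ → ℝ := fun T => ∑ t ∈ Finset.Icc 1 T, α t
  set R : ℕ → ℝ := fun T => ∑ t ∈ Finset.Icc 1 T, α t * X t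
  have hAs : ∀ n, A (n + 1) = A n + α (n + 1) := fun n =>
    Finset.sum_Icc_succ_top (by omega) _
  have hRs : ∀ n, R (n + 1) = R n + α (n + 1) * X (n + 1) := fun n =>
    Finset.sum_Icc_succ_top (by omega) _
  rw [Metric.tendsto_atTop]
  intro ε hε
  obtain ⟨m, hm⟩ := Metric.tendsto_atTop.1 hS (ε / 3) (by positivity)
  simp only [Real.dist_eq] at hm
  obtain ⟨C, hC⟩ : ∃ C : ℝ, |A m * X m - R m + S| ≤ ε / 3 + C * X m := by
    rcases (hX0 m).eq_or_lt with h | h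
    · refine ⟨0, ?_⟩
      have := (hm m le_rfl).le
      rw [abs_sub_comm] at this
      rwa [← h, mul_zero, mul_zero, add_zero, zero_sub, neg_add_eq_sub]
    · exact ⟨|A m * X m - R m + S| / X m, by rw [div_mul_cancel₀ _ h.ne']; linarith⟩
  have hbound : ∀ n, m ≤ n → |A n * X n - R n + S| ≤ ε / 3 + C * X n := by
    intro n hn
    induction n, hn using Nat.le_induction with
    | base => exact hC
    | succ n hn ih =>
      obtain ⟨r, hr0, hr1, hr⟩ := hratio n
      have hrec : A (n + 1) * X (n + 1) - R (n + 1) + S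
          = r * (A n * X n - R n + S) + (1 - r) * (S - R n) := by
        rw [hAs, hRs]
        linear_combination A n * hr
      have hSn := (hm n hn).le
      rw [abs_sub_comm] at hSn
      calc |A (n + 1) * X (n + 1) - R (n + 1) + S|
          ≤ r * |A n * X n - R n + S| + (1 - r) * |S - R n| := by
            rw [hrec]
            refine (abs_add_le _ _).trans_eq ?_
            rw [abs_mul, abs_mul, abs_of_nonneg hr0, abs_of_nonneg (sub_nonneg.2 hr1)]
        _ ≤ r * (ε / 3 + C * X n) + (1 - r) * (ε / 3) :=
            add_le_add (mul_le_mul_of_nonneg_left ih hr0)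
              (mul_le_mul_of_nonneg_left hSn (sub_nonneg.2 hr1))
        _ = ε / 3 + C * X (n + 1) := by rw [hr]; ring
  have hCX : ∀ᶠ n in atTop, C * X n < ε / 3 := by
    have h := hXlim.const_mul C
    rw [mul_zero] at h
    exact h.eventually_lt_const (by positivity)
  obtain ⟨k, hk⟩ := eventually_atTop.1 hCX
  refine ⟨max m k, fun n hn => ?_⟩
  have hmn := (le_max_left m k).trans hn
  have h₁ := abs_le.1 (hbound n hmn)
  have h₂ := abs_lt.1 (hm n hmn)
  have h₃ := hk n ((le_max_right m k).trans hn)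
  rw [Real.dist_eq, sub_zero, abs_lt]
  constructor <;> linarith [h₁.1, h₁.2, h₂.1, h₂.2]
end

section
/- Let {a_t}_{t≥1} and {b_t}_{t≥1} be nonnegative real sequences such that Σ_{t=1}^∞ a_t b_t < ∞, Σ_{t=1}^∞ a_t = ∞, and there exists K ≥ 0 with |b_{t+1} − b_t| ≤ K a_t for all t ≥ 1. Then lim_{t→∞} b_t = 0. -/
open MeasureTheory ProbabilityTheory Filter
open scoped RealInnerProductSpace ENNReal

/-- If `∑ a t * b t` converges and `∑ a t` diverges, then `b` takes arbitrarily small values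
arbitrarily late. -/
lemma frequently_lt_of_summable_mul {a b : ℕ → ℝ} (ha0 : ∀ t, 0 ≤ a t)
    (hsum : Summable (fun t => a t * b t)) (hdiv : ¬ Summable a) {ε : ℝ} (hε : 0 < ε) :
    ∃ᶠ t in atTop, b t < ε := by
  intro hev
  refine hdiv (Summable.of_norm_bounded_eventually_nat (hsum.mul_right ε⁻¹) ?_)
  filter_upwards [hev] with t ht
  rw [Real.norm_of_nonneg (ha0 t), ← div_eq_mul_inv, le_div_iff₀ hε]
  exact mul_le_mul_of_nonneg_left (not_lt.mp ht) (ha0 t)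

/-- If the decrements of `b` are at most `K * a t`, then `b t ^ 2` corrected by `2 * K` times the
partial sums of `a t * b t` is monotone. -/
lemma monotone_sq_add_sum_mul {a b : ℕ → ℝ} {K : ℝ} (ha0 : ∀ t, 0 ≤ a t) (hb0 : ∀ t, 0 ≤ b t)
    (hK : 0 ≤ K) (hdec : ∀ t, b t - b (t + 1) ≤ K * a t) :
    Monotone fun t => b t ^ 2 + 2 * K * ∑ i ∈ Finset.range t, a i * b i := by
  refine monotone_nat_of_le_succ fun t => ?_
  rw [Finset.sum_range_succ]
  have hKa : 0 ≤ K * a t := mul_nonneg hK (ha0 t)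
  rcases le_total (b t) (b (t + 1)) with h | h
  · nlinarith [pow_le_pow_left₀ (hb0 t) h 2, mul_nonneg hKa (hb0 t)]
  · nlinarith [mul_le_mul_of_nonneg_right (hdec t) (add_nonneg (hb0 t) (hb0 (t + 1))),
      mul_le_mul_of_nonneg_left h hKa]

/-- **An abstract convergence lemma (Lemma 3 of the paper).** -/
theorem tendsto_zero_of_summable_prod
    (a b : ℕ → ℝ)
    (ha0 : ∀ t, 0 ≤ a t) (hb0 : ∀ t, 0 ≤ b t)
    (hsum : Summable (fun t => a t * b t))
    (hdiv : Tendsto (fun T : ℕ => ∑ t ∈ Finset.range T, a t) atTop atTop)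
    (K : ℝ) (hK : 0 ≤ K)
    (hlip : ∀ t, |b (t + 1) - b t| ≤ K * a t) :
    Tendsto b atTop (nhds 0) := by
  have hna : ¬ Summable a := (not_summable_iff_tendsto_nat_atTop_of_nonneg ha0).mpr hdiv
  have hmono := monotone_sq_add_sum_mul ha0 hb0 hK fun t => by
    linarith [neg_abs_le (b (t + 1) - b t), hlip t]
  set S := ∑' t, a t * b t
  have hbound : ∀ t, b t ^ 2 ≤ 2 * K * (S - ∑ i ∈ Finset.range t, a i * b i) := by
    refine fun t => le_of_forall_pos_le_add fun ε hε => ?_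
    obtain ⟨s, hts, hs⟩ := ((eventually_ge_atTop t).and_frequently
      (frequently_lt_of_summable_mul ha0 hsum hna (Real.sqrt_pos.mpr hε))).exists
    have hsq : b s ^ 2 < ε := (Real.lt_sqrt (hb0 s)).mp hs
    have hpartial : ∑ i ∈ Finset.range s, a i * b i ≤ S :=
      hsum.sum_le_tsum _ fun i _ => mul_nonneg (ha0 i) (hb0 i)
    have hle := hmono hts
    dsimp only at hle
    linarith [mul_le_mul_of_nonneg_left hpartial (mul_nonneg zero_le_two hK)]
  have htail : Tendsto (fun t => 2 * K * (S - ∑ i ∈ Finset.range t, a i * b i)) atTop (nhds 0) := by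
    have hS : HasSum (fun t => a t * b t) S := hsum.hasSum
    simpa only [sub_self, mul_zero] using (hS.tendsto_sum_nat.const_sub S).const_mul (2 * K)
  have hsq : Tendsto (fun t => b t ^ 2) atTop (nhds 0) :=
    squeeze_zero (fun t => sq_nonneg _) hbound htail
  simpa [Real.sqrt_sq (hb0 _)] using hsq.sqrt
end

section
/- Let θ ∈ ℝ^d and α > 0. Then the expected value of the STP one-step decrease satisfies E_{s∼D}[ min( f(θ), f(θ + α s), f(θ − α s) ) ] ≤ f(θ) − μ_D α ‖∇f(θ)‖_D + (L/2) α². -/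
open MeasureTheory ProbabilityTheory Filter
open scoped RealInnerProductSpace ENNReal

/-- The descent lemma: a differentiable function with `L`-Lipschitz gradient is bounded above by
its first-order expansion plus `L / 2 * ‖v‖ ^ 2`. -/
theorem le_add_inner_gradient_add_sq_of_lipschitz_gradient
    {E : Type*} [NormedAddCommGroup E] [InnerProductSpace ℝ E] [CompleteSpace E]
    {f : E → ℝ} (hdiff : Differentiable ℝ f) {L : ℝ}
    (hsmooth : ∀ x y, ‖gradient f x - gradient f y‖ ≤ L * ‖x - y‖) (x v : E) :
    f (x + v) ≤ f x + ⟪gradient f x, v⟫ + L / 2 * ‖v‖ ^ 2 := by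
  let φ : ℝ → ℝ := fun t => f (x + t • v) - t * ⟪gradient f x, v⟫ - L / 2 * ‖v‖ ^ 2 * t ^ 2
  have hφ (t : ℝ) : HasDerivAt φ
      (⟪gradient f (x + t • v), v⟫ - ⟪gradient f x, v⟫ - L * ‖v‖ ^ 2 * t) t := by
    have hline : HasDerivAt (fun t : ℝ => x + t • v) v t := by
      simpa using ((hasDerivAt_id t).smul_const v).const_add x
    have hf : HasDerivAt (fun t : ℝ => f (x + t • v)) ⟪gradient f (x + t • v), v⟫ t := by
      have h := (hdiff (x + t • v)).hasGradientAt.hasFDerivAt.comp_hasDerivAt t hline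
      rwa [InnerProductSpace.toDual_apply_apply] at h
    refine ((hf.sub ((hasDerivAt_id t).mul_const ⟪gradient f x, v⟫)).sub
      ((hasDerivAt_pow 2 t).const_mul (L / 2 * ‖v‖ ^ 2))).congr_deriv ?_
    norm_num
    ring
  have hanti : AntitoneOn φ (Set.Ici 0) := by
    refine antitoneOn_of_deriv_nonpos (convex_Ici 0)
      (fun t _ => (hφ t).continuousAt.continuousWithinAt)
      (fun t _ => (hφ t).differentiableAt.differentiableWithinAt) fun t ht => ?_
    rw [interior_Ici, Set.mem_Ioi] at ht
    rw [(hφ t).deriv, ← inner_sub_left, sub_nonpos]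
    calc ⟪gradient f (x + t • v) - gradient f x, v⟫
        ≤ ‖gradient f (x + t • v) - gradient f x‖ * ‖v‖ := real_inner_le_norm _ _
      _ ≤ L * ‖x + t • v - x‖ * ‖v‖ := by gcongr; exact hsmooth _ _
      _ = L * ‖v‖ ^ 2 * t := by
        rw [add_sub_cancel_left, norm_smul, Real.norm_of_nonneg ht.le]
        ring
  have h := hanti (Set.mem_Ici.2 le_rfl) (Set.mem_Ici.2 zero_le_one) zero_le_one
  simp only [φ, one_smul, zero_smul, add_zero] at h
  linarith

/-- A continuous function is integrable against a finite measure carried by a closed ball of a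
proper space. -/
theorem Continuous.integrable_of_ae_norm_le {E : Type*} [NormedAddCommGroup E] [ProperSpace E]
    [MeasurableSpace E] [BorelSpace E] {μ : Measure E} [IsFiniteMeasure μ] {R : ℝ}
    (hμ : ∀ᵐ x ∂μ, ‖x‖ ≤ R) {g : E → ℝ} (hg : Continuous g) : Integrable g μ := by
  obtain ⟨C, hC⟩ := (isCompact_closedBall (0 : E) R).exists_bound_of_continuousOn hg.continuousOn
  refine Integrable.of_bound hg.measurable.aestronglyMeasurable C ?_
  filter_upwards [hμ] with x hx
  exact hC x (by simpa using hx)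

/-- **Expected one-step decrease of STP (Lemma 3.5 of Bergou et al.).** -/
theorem stp_expected_one_step_decrease
    {d : ℕ} (hd : 1 ≤ d)
    (f : EuclideanSpace ℝ (Fin d) → ℝ)
    (hdiff : Differentiable ℝ f)
    (L : ℝ) (hL : 0 < L)
    (hsmooth : ∀ x y, ‖gradient f x - gradient f y‖ ≤ L * ‖x - y‖)
    (D : Measure (EuclideanSpace ℝ (Fin d))) [IsProbabilityMeasure D]
    (N : EuclideanSpace ℝ (Fin d) → ℝ)
    (hN0 : ∀ x, 0 ≤ N x)
    (hN1 : ∀ x y, N (x + y) ≤ N x + N y)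
    (hN2 : ∀ (a : ℝ) x, N (a • x) = |a| * N x)
    (hN3 : ∀ x, N x = 0 → x = 0)
    (μD : ℝ) (hμD : 0 < μD)
    (hD2 : ∀ v, μD * N v ≤ ∫ x, abs ⟪v, x⟫ ∂D)
    (hD3 : ∀ᵐ x ∂D, ‖x‖ ≤ 1)
    (θ : EuclideanSpace ℝ (Fin d)) (a : ℝ) (ha : 0 < a) :
    ∫ x, min (f θ) (min (f (θ + a • x)) (f (θ - a • x))) ∂D ≤
      f θ - μD * a * N (gradient f θ) + L / 2 * a ^ 2 := by
  have hf := hdiff.continuous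
  have habs : Integrable (fun x => |⟪gradient f θ, x⟫|) D :=
    Continuous.integrable_of_ae_norm_le hD3 (by fun_prop)
  have hbound : ∀ᵐ x ∂D, min (f θ) (min (f (θ + a • x)) (f (θ - a • x))) ≤
      f θ + L / 2 * a ^ 2 - a * |⟪gradient f θ, x⟫| := by
    filter_upwards [hD3] with x hx
    refine (min_le_right _ _).trans ?_
    have hplus := le_add_inner_gradient_add_sq_of_lipschitz_gradient hdiff hsmooth θ (a • x)
    have hminus := le_add_inner_gradient_add_sq_of_lipschitz_gradient hdiff hsmooth θ (-(a • x))
    rw [inner_neg_right, norm_neg, ← sub_eq_add_neg] at hminus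
    rw [real_inner_smul_right] at hplus hminus
    have hsq : L / 2 * ‖a • x‖ ^ 2 ≤ L / 2 * a ^ 2 := by
      rw [norm_smul, Real.norm_of_nonneg ha.le]
      gcongr
      exact mul_le_of_le_one_right ha.le hx
    rcases abs_cases ⟪gradient f θ, x⟫ with ⟨h, -⟩ | ⟨h, -⟩ <;> rw [h]
    · exact (min_le_right _ _).trans (by linarith)
    · exact (min_le_left _ _).trans (by linarith)
  calc ∫ x, min (f θ) (min (f (θ + a • x)) (f (θ - a • x))) ∂D
      ≤ ∫ x, (f θ + L / 2 * a ^ 2 - a * |⟪gradient f θ, x⟫|) ∂D :=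
        integral_mono_ae (Continuous.integrable_of_ae_norm_le hD3 (by fun_prop))
          ((integrable_const _).sub (habs.const_mul a)) hbound
    _ = f θ + L / 2 * a ^ 2 - a * ∫ x, |⟪gradient f θ, x⟫| ∂D := by
        rw [integral_sub (integrable_const _) (habs.const_mul a), integral_const_mul]
        simp
    _ ≤ f θ - μD * a * N (gradient f θ) + L / 2 * a ^ 2 := by
        linarith [mul_le_mul_of_nonneg_left (hD2 (gradient f θ)) ha.le]
end
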